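/- Let p > 1 with p ≠ Q and let 0 < r < R. The function u_{r,R}(z) = (ρ(z)^{−(Q−p)/(p−1)} − R^{−(Q−p)/(p−1)}) / (r^{−(Q−p)/(p−1)} − R^{−(Q−p)/(p−1)}) is continuous on closure(B_ρ(O,R))∖B_ρ(O,r), weakly horizontally p-harmonic in B_ρ(O,R)∖closure(B_ρ(O,r)), and satisfies u_{r,R} = 1 on ∂B_ρ(O,r) and u_{r,R} = 0 on ∂B_ρ(O,R); i.e., it solves the capacitary problem for the annulus between the concentric gauge balls B_ρ(O,r) and B_ρ(O,R). -/

import Mathlib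

open MeasureTheory Real Set

noncomputable section

/-- The underlying space of the Heisenberg group `ℍⁿ`, i.e. `ℝ^(2n+1)`,
with coordinates `(x₁, …, xₙ, y₁, …, yₙ, t)`. -/
abbrev Heis (n : ℕ) := Fin (2 * n + 1) → ℝ

namespace Heis

variable {n : ℕ}

/-- The index of the coordinate `xᵢ`. -/
def xIdx (n : ℕ) (i : Fin n) : Fin (2 * n + 1) := ⟨(i : ℕ), by have := i.isLt; omega⟩

/-- The index of the coordinate `yᵢ`. -/
def yIdx (n : ℕ) (i : Fin n) : Fin (2 * n + 1) := ⟨n + (i : ℕ), by have := i.isLt; omega⟩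

/-- The index of the coordinate `t`. -/
def tIdx (n : ℕ) : Fin (2 * n + 1) := ⟨2 * n, by omega⟩

/-- The Heisenberg group product. -/
def mul (z w : Heis n) : Heis n := fun k =>
  if (k : ℕ) = 2 * n then
    z k + w k + 2 * ∑ i : Fin n,
      (w (xIdx n i) * z (yIdx n i) - z (xIdx n i) * w (yIdx n i))
  else z k + w k

/-- The Heisenberg group inverse. -/
def inv (z : Heis n) : Heis n := fun k => - z k

/-- The Koranyi gauge `ρ`. -/
def rho (z : Heis n) : ℝ :=
  ((∑ i : Fin n, (z (xIdx n i) ^ 2 + z (yIdx n i) ^ 2)) ^ 2 + z (tIdx n) ^ 2) ^ ((1 : ℝ) / 4)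

/-- The gauge ball `B_ρ(z, R) = {w | ρ(w⁻¹ ⬝ z) < R}`. -/
def gaugeBall (z : Heis n) (R : ℝ) : Set (Heis n) := {w | rho (mul (inv w) z) < R}

/-- The anisotropic dilations `δ_λ`. -/
def dil (lam : ℝ) (z : Heis n) : Heis n := fun k =>
  if (k : ℕ) = 2 * n then Real.exp (2 * lam) * z k else Real.exp lam * z k

/-- The dilation-generating vector field `Z(z) = (x₁, …, xₙ, y₁, …, yₙ, 2t)`. -/
def Zvf (z : Heis n) : Heis n := fun k => if (k : ℕ) = 2 * n then 2 * z k else z k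

/-- The Euclidean scalar product of `ℝ^(2n+1)`. -/
def einner (v w : Heis n) : ℝ := ∑ k, v k * w k

/-- The Euclidean norm of `ℝ^(2n+1)`. -/
def euclNorm (v : Heis n) : ℝ := Real.sqrt (∑ k, v k ^ 2)

/-- The Euclidean gradient of `f`, via the Fréchet derivative. -/
def grad (f : Heis n → ℝ) (z : Heis n) : Heis n := fun k => fderiv ℝ f z (Pi.single k 1)

/-- The horizontal derivative `Xᵢ f = ∂f/∂xᵢ + 2 yᵢ ∂f/∂t`. -/
def Xd (i : Fin n) (f : Heis n → ℝ) (z : Heis n) : ℝ :=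
  grad f z (xIdx n i) + 2 * z (yIdx n i) * grad f z (tIdx n)

/-- The horizontal derivative `Yⱼ f = ∂f/∂yⱼ − 2 xⱼ ∂f/∂t`. -/
def Yd (i : Fin n) (f : Heis n → ℝ) (z : Heis n) : ℝ :=
  grad f z (yIdx n i) - 2 * z (xIdx n i) * grad f z (tIdx n)

/-- The horizontal gradient `∇_ℍ f = (X₁ f, …, Xₙ f, Y₁ f, …, Yₙ f)`. -/
def hGrad (f : Heis n → ℝ) (z : Heis n) : (Fin n → ℝ) × (Fin n → ℝ) :=
  (fun i => Xd i f z, fun i => Yd i f z)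

/-- The norm `|∇_ℍ f|` of the horizontal gradient. -/
def hNorm (f : Heis n → ℝ) (z : Heis n) : ℝ :=
  Real.sqrt (∑ i : Fin n, ((Xd i f z) ^ 2 + (Yd i f z) ^ 2))

/-- `f` is weakly horizontally `p`-harmonic on the open set `U` :
`f` and `∇_ℍ f` are locally `p`-integrable on `U` and
`∫_U |∇_ℍ f|^(p−2) ⟨∇_ℍ f, ∇_ℍ φ⟩ = 0` for every `C¹` function `φ`
with compact support contained in `U` (note that `Real.rpow` makes the
integrand vanish at points where `∇_ℍ f = 0`). -/
def PHarmonicOn (p : ℝ) (f : Heis n → ℝ) (U : Set (Heis n)) : Prop :=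
  LocallyIntegrableOn (fun z => |f z| ^ p) U volume ∧
  LocallyIntegrableOn (fun z => hNorm f z ^ p) U volume ∧
  ∀ φ : Heis n → ℝ, ContDiff ℝ 1 φ → HasCompactSupport φ → tsupport φ ⊆ U →
    ∫ z in U, hNorm f z ^ (p - 2) *
      (∑ i : Fin n, (Xd i f z * Xd i φ z + Yd i f z * Yd i φ z)) = 0

/-- `Ω` has `C¹` boundary, with Euclidean outward unit normal `ν` on `∂Ω` :
near every boundary point, `Ω` is the sublevel set of a `C¹` defining function
with nonvanishing (Euclidean) gradient, and `ν` is the normalized gradient. -/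
def HasC1Boundary (Ω : Set (Heis n)) (ν : Heis n → Heis n) : Prop :=
  ∀ z ∈ frontier Ω, ∃ (V : Set (Heis n)) (g : Heis n → ℝ),
    IsOpen V ∧ z ∈ V ∧ ContDiff ℝ 1 g ∧
    (∀ w ∈ V, (w ∈ interior Ω ↔ g w < 0)) ∧
    (∀ w ∈ V, (w ∈ frontier Ω ↔ g w = 0)) ∧
    (∀ w ∈ V, w ∈ frontier Ω →
      grad g w ≠ 0 ∧ ν w = (euclNorm (grad g w))⁻¹ • grad g w)

/-- `Ω` (with `C¹` boundary and Euclidean outward unit normal `ν`) is strictly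
starshaped with respect to the origin : it contains the origin and `⟨ν, Z⟩ > 0`
everywhere on `∂Ω`. -/
def StrictStarshaped (Ω : Set (Heis n)) (ν : Heis n → Heis n) : Prop :=
  (0 : Heis n) ∈ Ω ∧ HasC1Boundary Ω ν ∧
    ∀ z ∈ frontier Ω, 0 < einner (ν z) (Zvf z)

/-- `Ω` satisfies the exterior gauge ball property at `z ∈ ∂Ω`, with exterior
tangent gauge ball `B_ρ(z₁, R)`. -/
def ExteriorGaugeBallAt (Ω : Set (Heis n)) (z z₁ : Heis n) (R : ℝ) : Prop :=
  z₁ ∉ closure Ω ∧ gaugeBall z₁ R ⊆ (closure Ω)ᶜ ∧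
    closure (gaugeBall z₁ R) ∩ frontier Ω = {z}

/-- `Ω` satisfies a uniform exterior gauge ball property. -/
def UniformExteriorGaugeBall (Ω : Set (Heis n)) : Prop :=
  ∃ R > 0, ∀ z ∈ frontier Ω, ∃ z₁, ExteriorGaugeBallAt Ω z z₁ R

/-- `Ω` satisfies the interior gauge ball property at `z ∈ ∂Ω`, with interior
tangent gauge ball `B_ρ(z₂, R)`. -/
def InteriorGaugeBallAt (Ω : Set (Heis n)) (z z₂ : Heis n) (R : ℝ) : Prop :=
  z₂ ∈ Ω ∧ gaugeBall z₂ R ⊆ Ω ∧ closure (gaugeBall z₂ R) ∩ frontier Ω = {z}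

/-- `Ω` satisfies a uniform interior gauge ball property. -/
def UniformInteriorGaugeBall (Ω : Set (Heis n)) : Prop :=
  ∃ R > 0, ∀ z ∈ frontier Ω, ∃ z₂, InteriorGaugeBallAt Ω z z₂ R

end Heis

section Flow

/-- If the weight `g` absorbs the Jacobian of the linear map `T`, then composing with `T` does not
change integrals against `g`. -/
theorem integral_mul_comp_linearMap {E : Type*} [NormedAddCommGroup E] [NormedSpace ℝ E]
    [FiniteDimensional ℝ E] [MeasurableSpace E] [BorelSpace E] (μ : Measure E)
    [μ.IsAddHaarMeasure] (T : E →ₗ[ℝ] E) (hT : LinearMap.det T ≠ 0) (g φ : E → ℝ)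
    (hg : ∀ z, |LinearMap.det T| * g (T z) = g z) :
    ∫ z, g z * φ (T z) ∂μ = ∫ z, g z * φ z ∂μ := by
  have hemb : MeasurableEmbedding T :=
    ((LinearEquiv.ofIsUnitDet (v := Module.finBasis ℝ E) (v' := Module.finBasis ℝ E) (f := T)
      (by rw [LinearMap.det_toMatrix]; exact hT.isUnit)).toContinuousLinearEquiv
        |>.toHomeomorph).measurableEmbedding
  have h := hemb.integral_map (μ := μ) (fun z => g z * φ z)
  rw [Measure.map_linearMap_addHaar_eq_smul_addHaar μ hT, integral_smul_measure,
    ENNReal.toReal_ofReal (abs_nonneg _), abs_inv] at h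
  have hpos : |LinearMap.det T| ≠ 0 := abs_ne_zero.2 hT
  calc ∫ z, g z * φ (T z) ∂μ = ∫ z, |LinearMap.det T| * (g (T z) * φ (T z)) ∂μ := by
        congr 1; ext z; rw [← hg z]; ring
    _ = |LinearMap.det T| * ∫ z, g (T z) * φ (T z) ∂μ := integral_const_mul _ _
    _ = ∫ z, g z * φ z ∂μ := by
        rw [← h, smul_eq_mul, ← mul_assoc, mul_inv_cancel₀ hpos, one_mul]

/-- Let `T` be a linear flow with generator `A` and let `g` be a weight, locally integrable away
from the origin, that absorbs the Jacobian of the flow. Then `A` is weakly divergence free with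
respect to `g` away from the origin. -/
theorem integral_mul_fderiv_flow_eq_zero {E : Type*} [NormedAddCommGroup E] [NormedSpace ℝ E]
    [FiniteDimensional ℝ E] [MeasurableSpace E] [BorelSpace E] (μ : Measure E)
    [μ.IsAddHaarMeasure] (T : ℝ → E →ₗ[ℝ] E) (A : E → E) (hA : Continuous A)
    (hcont : Continuous fun q : ℝ × E => T q.1 q.2)
    (hderiv : ∀ s z, HasDerivAt (fun s => T s z) (A (T s z)) s)
    (hzero : ∀ z, T 0 z = z) (hinv : ∀ s z, T (-s) (T s z) = z)
    (g : E → ℝ) (hgm : Measurable g)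
    (hgint : ∀ K : Set E, IsCompact K → (0 : E) ∉ K → IntegrableOn g K μ)
    (hg : ∀ s z, |LinearMap.det (T s)| * g (T s z) = g z)
    (φ : E → ℝ) (hφ : ContDiff ℝ 1 φ) (hφc : HasCompactSupport φ) (hφ0 : (0 : E) ∉ tsupport φ) :
    Integrable (fun z => g z * fderiv ℝ φ z (A z)) μ ∧
      ∫ z, g z * fderiv ℝ φ z (A z) ∂μ = 0 := by
  have hdet : ∀ s, LinearMap.det (T s) ≠ 0 := by
    intro s h0
    have hcomp : T (-s) ∘ₗ T s = LinearMap.id := LinearMap.ext (hinv s)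
    have := congrArg LinearMap.det hcomp
    rw [LinearMap.det_comp, h0, mul_zero, LinearMap.det_id] at this
    exact zero_ne_one this
  set h : E → ℝ := fun w => fderiv ℝ φ w (A w) with hh
  have hhc : Continuous h := (hφ.continuous_fderiv one_ne_zero).clm_apply hA
  have hhsupp : ∀ w, w ∉ tsupport φ → h w = 0 := by
    intro w hw
    have : fderiv ℝ φ w = 0 := by
      by_contra hne
      exact hw (support_fderiv_subset ℝ hne)
    simp [hh, this]
  have hhcs : HasCompactSupport h := HasCompactSupport.intro hφc hhsupp
  obtain ⟨C, hC⟩ := hhcs.exists_bound_of_continuous hhc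
  obtain ⟨C', hC'⟩ := hφc.exists_bound_of_continuous hφ.continuous
  set K : Set E := (fun q : ℝ × E => T (-q.1) q.2) '' (Icc (-1) 1 ×ˢ tsupport φ) with hK
  have hKc : IsCompact K := (isCompact_Icc.prod hφc).image
    (hcont.comp (continuous_fst.neg.prodMk continuous_snd))
  have hK0 : (0 : E) ∉ K := by
    rintro ⟨⟨s, w⟩, ⟨-, hw⟩, hsw⟩
    have h1 := hinv (-s) w
    simp only at hsw
    rw [hsw, map_zero] at h1
    rw [← h1] at hw
    exact hφ0 hw
  have hmem : ∀ s ∈ Icc (-1 : ℝ) 1, ∀ z, T s z ∈ tsupport φ → z ∈ K := fun s hs z hz =>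
    ⟨(s, T s z), ⟨hs, hz⟩, hinv s z⟩
  have hTc : ∀ s, Continuous (T s) := fun s => hcont.comp (Continuous.prodMk_right s)
  have hbd : ∀ (k : E → ℝ) (B : ℝ), (∀ w, ‖k w‖ ≤ B) → (∀ w, w ∉ tsupport φ → k w = 0) →
      ∀ s ∈ Icc (-1 : ℝ) 1, ∀ z, ‖g z * k (T s z)‖ ≤ K.indicator (fun z => |g z| * B) z := by
    intro k B hB hk s hs z
    by_cases hz : z ∈ K
    · rw [indicator_of_mem hz, norm_mul, Real.norm_eq_abs]
      exact mul_le_mul_of_nonneg_left (hB _) (abs_nonneg _)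
    · rw [indicator_of_notMem hz, hk _ fun h => hz (hmem s hs z h), mul_zero, norm_zero]
  have hbdint : ∀ B : ℝ, Integrable (K.indicator fun z => |g z| * B) μ := fun B =>
    (integrable_indicator_iff hKc.measurableSet).2 ((hgint K hKc hK0).abs.mul_const B)
  have h0 : (0 : ℝ) ∈ Icc (-1 : ℝ) 1 := by norm_num
  have hφsupp : ∀ w, w ∉ tsupport φ → φ w = 0 := fun w => image_eq_zero_of_notMem_tsupport
  have key := (hasDerivAt_integral_of_dominated_loc_of_deriv_le (μ := μ) (𝕜 := ℝ)
    (F := fun s z => g z * φ (T s z)) (F' := fun s z => g z * h (T s z)) (x₀ := 0)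
    (bound := K.indicator fun z => |g z| * C) (s := Icc (-1) 1)
    (Icc_mem_nhds (by norm_num) (by norm_num))
    (Filter.Eventually.of_forall fun s =>
      (hgm.mul (hφ.continuous.comp (hTc s)).measurable).aestronglyMeasurable)
    ((hbdint C').mono' (hgm.mul (hφ.continuous.comp (hTc 0)).measurable).aestronglyMeasurable
      (Filter.Eventually.of_forall (hbd φ C' hC' hφsupp 0 h0)))
    (hgm.mul (hhc.comp (hTc 0)).measurable).aestronglyMeasurable
    (Filter.Eventually.of_forall fun z s hs => hbd h C hC hhsupp s hs z)
    (hbdint C)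
    (Filter.Eventually.of_forall fun z s _ =>
      (((hφ.differentiable one_ne_zero (T s z)).hasFDerivAt.comp_hasDerivAt s
        (hderiv s z)).const_mul (g z))))
  have hconst : (fun s => ∫ z, g z * φ (T s z) ∂μ) = fun _ => ∫ z, g z * φ z ∂μ :=
    funext fun s => integral_mul_comp_linearMap μ (T s) (hdet s) g φ (hg s)
  rw [hconst] at key
  simpa only [hzero] using And.intro key.1 (key.2.unique (hasDerivAt_const _ _))

end Flow

namespace Heis

variable {n : ℕ}

/-- The squared Euclidean norm `Σᵢ xᵢ² + yᵢ²` of the horizontal part. -/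
def horSq (z : Heis n) : ℝ := ∑ i : Fin n, (z (xIdx n i) ^ 2 + z (yIdx n i) ^ 2)

/-- The fourth power of the Koranyi gauge. -/
def gaugeFourth (z : Heis n) : ℝ := horSq z ^ 2 + z (tIdx n) ^ 2

/-- The generator `(y, -x, 0)` of the rotations of the horizontal plane. -/
def rotGen (z : Heis n) : Heis n := fun k =>
  if h : (k : ℕ) < n then z ⟨n + k, by omega⟩
  else if h' : (k : ℕ) < 2 * n then -z ⟨k - n, by omega⟩
  else 0

/-- The simultaneous rotation by the angle `s` of all the planes `(xᵢ, yᵢ)`. -/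
def rot (s : ℝ) (z : Heis n) : Heis n := fun k =>
  if (k : ℕ) = 2 * n then z k else Real.cos s * z k + Real.sin s * rotGen z k

theorem rho_eq (z : Heis n) : rho z = gaugeFourth z ^ ((1 : ℝ) / 4) := rfl

theorem xIdx_ne (i : Fin n) : ((xIdx n i : Fin (2 * n + 1)) : ℕ) ≠ 2 * n := by
  have := i.isLt; simp only [xIdx]; omega

theorem yIdx_ne (i : Fin n) : ((yIdx n i : Fin (2 * n + 1)) : ℕ) ≠ 2 * n := by
  have := i.isLt; simp only [yIdx]; omega

theorem sum_coord {M : Type*} [AddCommMonoid M] (f : Fin (2 * n + 1) → M) :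
    ∑ k, f k = ∑ i : Fin n, (f (xIdx n i) + f (yIdx n i)) + f (tIdx n) := by
  rw [Fin.sum_univ_castSucc, ← Fin.sum_congr' _ (two_mul n).symm, Fin.sum_univ_add,
    Finset.sum_add_distrib]
  rfl

theorem coord_cases {P : Fin (2 * n + 1) → Prop} (hx : ∀ i, P (xIdx n i)) (hy : ∀ i, P (yIdx n i))
    (ht : P (tIdx n)) (k : Fin (2 * n + 1)) : P k := by
  rcases lt_trichotomy (k : ℕ) (2 * n) with h | h | h
  · by_cases h' : (k : ℕ) < n
    · exact hx ⟨k, h'⟩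
    · have : k = yIdx n ⟨k - n, by omega⟩ := by
        ext; simp only [yIdx]; omega
      rw [this]; exact hy _
  · have : k = tIdx n := by ext; exact h
    rw [this]; exact ht
  · omega

@[simp] theorem rotGen_xIdx (z : Heis n) (i : Fin n) : rotGen z (xIdx n i) = z (yIdx n i) := by
  simp [rotGen, xIdx, yIdx]

@[simp] theorem rotGen_yIdx (z : Heis n) (i : Fin n) : rotGen z (yIdx n i) = -z (xIdx n i) := by
  have := i.isLt
  simp [rotGen, xIdx, yIdx, show n + (i : ℕ) < 2 * n by omega]

@[simp] theorem rotGen_tIdx (z : Heis n) : rotGen z (tIdx n) = 0 := by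
  have : ¬ 2 * n < n := by omega
  simp [rotGen, tIdx, this]

@[simp] theorem rot_xIdx (s : ℝ) (z : Heis n) (i : Fin n) :
    rot s z (xIdx n i) = Real.cos s * z (xIdx n i) + Real.sin s * z (yIdx n i) := by
  simp [rot, xIdx_ne]

@[simp] theorem rot_yIdx (s : ℝ) (z : Heis n) (i : Fin n) :
    rot s z (yIdx n i) = Real.cos s * z (yIdx n i) - Real.sin s * z (xIdx n i) := by
  simp [rot, yIdx_ne, sub_eq_add_neg]

@[simp] theorem rot_tIdx (s : ℝ) (z : Heis n) : rot s z (tIdx n) = z (tIdx n) := by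
  simp [rot, tIdx]

@[simp] theorem dil_xIdx (s : ℝ) (z : Heis n) (i : Fin n) :
    dil s z (xIdx n i) = Real.exp s * z (xIdx n i) := by
  simp [dil, xIdx_ne]

@[simp] theorem dil_yIdx (s : ℝ) (z : Heis n) (i : Fin n) :
    dil s z (yIdx n i) = Real.exp s * z (yIdx n i) := by
  simp [dil, yIdx_ne]

@[simp] theorem dil_tIdx (s : ℝ) (z : Heis n) :
    dil s z (tIdx n) = Real.exp (2 * s) * z (tIdx n) := by
  simp [dil, tIdx]

@[simp] theorem Zvf_xIdx (z : Heis n) (i : Fin n) : Zvf z (xIdx n i) = z (xIdx n i) := by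
  simp [Zvf, xIdx_ne]

@[simp] theorem Zvf_yIdx (z : Heis n) (i : Fin n) : Zvf z (yIdx n i) = z (yIdx n i) := by
  simp [Zvf, yIdx_ne]

@[simp] theorem Zvf_tIdx (z : Heis n) : Zvf z (tIdx n) = 2 * z (tIdx n) := by
  simp [Zvf, tIdx]

theorem continuous_horSq : Continuous (horSq (n := n)) := by unfold horSq; fun_prop

theorem continuous_gaugeFourth : Continuous (gaugeFourth (n := n)) := by
  have := continuous_horSq (n := n)
  unfold gaugeFourth; fun_prop

theorem horSq_nonneg (z : Heis n) : 0 ≤ horSq z := Finset.sum_nonneg fun _ _ => by positivity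

theorem gaugeFourth_nonneg (z : Heis n) : 0 ≤ gaugeFourth z := by unfold gaugeFourth; positivity

theorem horSq_eq_zero {z : Heis n} (h : horSq z = 0) (i : Fin n) :
    z (xIdx n i) = 0 ∧ z (yIdx n i) = 0 := by
  have := (Finset.sum_eq_zero_iff_of_nonneg (fun _ _ => by positivity)).1 h i (Finset.mem_univ i)
  constructor <;> nlinarith [sq_nonneg (z (xIdx n i)), sq_nonneg (z (yIdx n i))]

theorem gaugeFourth_pos {z : Heis n} (hz : z ≠ 0) : 0 < gaugeFourth z := by
  refine lt_of_le_of_ne (gaugeFourth_nonneg z) fun h => hz ?_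
  unfold gaugeFourth at h
  have h1 : horSq z = 0 := by nlinarith [sq_nonneg (horSq z), sq_nonneg (z (tIdx n))]
  have h2 : z (tIdx n) = 0 := by nlinarith [sq_nonneg (horSq z), sq_nonneg (z (tIdx n))]
  exact funext (coord_cases (fun i => (horSq_eq_zero h1 i).1) (fun i => (horSq_eq_zero h1 i).2) h2)

theorem gaugeFourth_zero : gaugeFourth (0 : Heis n) = 0 := by simp [gaugeFourth, horSq]

theorem horSq_dil (s : ℝ) (z : Heis n) : horSq (dil s z) = Real.exp (2 * s) * horSq z := by
  simp only [horSq, dil_xIdx, dil_yIdx, Finset.mul_sum, two_mul, Real.exp_add]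
  exact Finset.sum_congr rfl fun _ _ => by ring

theorem gaugeFourth_dil (s : ℝ) (z : Heis n) :
    gaugeFourth (dil s z) = Real.exp (4 * s) * gaugeFourth z := by
  rw [gaugeFourth, horSq_dil, dil_tIdx, gaugeFourth, show 4 * s = 2 * s + 2 * s by ring,
    Real.exp_add]
  ring

theorem horSq_rot (s : ℝ) (z : Heis n) : horSq (rot s z) = horSq z := by
  simp only [horSq, rot_xIdx, rot_yIdx]
  exact Finset.sum_congr rfl fun i _ => by
    linear_combination (z (xIdx n i) ^ 2 + z (yIdx n i) ^ 2) * Real.sin_sq_add_cos_sq s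

theorem gaugeFourth_rot (s : ℝ) (z : Heis n) : gaugeFourth (rot s z) = gaugeFourth z := by
  simp only [gaugeFourth, horSq_rot, rot_tIdx]

theorem continuous_Zvf : Continuous (Zvf (n := n)) := by
  refine continuous_pi (coord_cases ?_ ?_ ?_) <;> intros <;> simp <;> fun_prop

theorem continuous_rotGen : Continuous (rotGen (n := n)) := by
  refine continuous_pi (coord_cases ?_ ?_ ?_) <;> intros <;> simp <;> fun_prop

/-- The dilation `δ_s` as a linear map. -/
def dilLin (s : ℝ) : Heis n →ₗ[ℝ] Heis n :=
  LinearMap.pi fun k =>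
    ((if (k : ℕ) = 2 * n then Real.exp (2 * s) else Real.exp s) • LinearMap.id) ∘ₗ
      LinearMap.proj k

theorem dilLin_apply (s : ℝ) (z : Heis n) : dilLin s z = dil s z := by
  ext k
  simp only [dilLin, dil, LinearMap.pi_apply, LinearMap.comp_apply, LinearMap.smul_apply,
    LinearMap.proj_apply, LinearMap.id_apply, smul_eq_mul]
  split_ifs <;> rfl

theorem det_dilLin (s : ℝ) :
    LinearMap.det (dilLin (n := n) s) = Real.exp ((2 * n + 2) * s) := by
  have hx : ∀ i : Fin (2 * n), ((i.castSucc : Fin (2 * n + 1)) : ℕ) ≠ 2 * n := fun i => by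
    have := i.isLt; simp only [Fin.val_castSucc]; omega
  rw [dilLin, LinearMap.det_pi, Fin.prod_univ_castSucc]
  simp only [hx, Fin.val_last, if_true, if_false, LinearMap.det_smul, LinearMap.det_id,
    Module.finrank_self, pow_one, mul_one, Finset.prod_const, Finset.card_univ, Fintype.card_fin]
  rw [← Real.exp_nat_mul, ← Real.exp_add]
  congr 1; push_cast; ring

/-- The rotation `rot s` as a linear map. -/
def rotLin (s : ℝ) : Heis n →ₗ[ℝ] Heis n where
  toFun := rot s
  map_add' z w := by
    refine funext (coord_cases ?_ ?_ ?_) <;> intros <;> simp <;> ring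
  map_smul' c z := by
    refine funext (coord_cases ?_ ?_ ?_) <;> intros <;> simp <;> ring

theorem rot_neg_rot (s : ℝ) (z : Heis n) : rot (-s) (rot s z) = z := by
  have h := Real.sin_sq_add_cos_sq s
  refine funext (coord_cases (fun i => ?_) (fun i => ?_) ?_)
  · simp only [rot_xIdx, rot_yIdx, Real.cos_neg, Real.sin_neg]
    linear_combination z (xIdx n i) * h
  · simp only [rot_xIdx, rot_yIdx, Real.cos_neg, Real.sin_neg]
    linear_combination z (yIdx n i) * h
  · simp

theorem isBounded_gaugeFourth_lt_one : Bornology.IsBounded {z : Heis n | gaugeFourth z < 1} := by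
  refine (Metric.isBounded_closedBall (x := (0 : Heis n)) (r := 1)).subset fun z hz => ?_
  have hz : horSq z ^ 2 + z (tIdx n) ^ 2 < 1 := hz
  have hS : horSq z ≤ 1 := by nlinarith [horSq_nonneg z, sq_nonneg (z (tIdx n))]
  have hi : ∀ i, z (xIdx n i) ^ 2 + z (yIdx n i) ^ 2 ≤ 1 := fun i =>
    (Finset.single_le_sum (f := fun i => z (xIdx n i) ^ 2 + z (yIdx n i) ^ 2)
      (fun _ _ => by positivity) (Finset.mem_univ i)).trans hS
  rw [mem_closedBall_zero_iff, pi_norm_le_iff_of_nonneg zero_le_one]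
  refine coord_cases (fun i => ?_) (fun i => ?_) ?_ <;>
    rw [Real.norm_eq_abs, ← sq_le_one_iff_abs_le_one]
  · nlinarith [hi i, sq_nonneg (z (yIdx n i))]
  · nlinarith [hi i, sq_nonneg (z (xIdx n i))]
  · nlinarith [sq_nonneg (horSq z)]

theorem abs_det_rotLin (s : ℝ) : |LinearMap.det (rotLin (n := n) s)| = 1 := by
  have hdet : LinearMap.det (rotLin (n := n) s) ≠ 0 := by
    intro h0
    have hcomp : rotLin (n := n) (-s) ∘ₗ rotLin s = LinearMap.id := LinearMap.ext (rot_neg_rot s)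
    have := congrArg LinearMap.det hcomp
    rw [LinearMap.det_comp, h0, mul_zero, LinearMap.det_id] at this
    exact zero_ne_one this
  set B : Set (Heis n) := {z | gaugeFourth z < 1} with hB
  have hpre : rotLin (n := n) s ⁻¹' B = B := by
    ext z; change gaugeFourth (rot s z) < 1 ↔ gaugeFourth z < 1; rw [gaugeFourth_rot]
  have hne : volume B ≠ 0 :=
    ((isOpen_lt continuous_gaugeFourth continuous_const).measure_pos volume
      ⟨0, by simp [gaugeFourth_zero]⟩).ne'
  have h := Measure.addHaar_preimage_linearMap volume hdet B
  rw [hpre] at h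
  have h1 : ENNReal.ofReal |(LinearMap.det (rotLin (n := n) s))⁻¹| = 1 := by
    rw [eq_comm, ← ENNReal.mul_left_inj hne isBounded_gaugeFourth_lt_one.measure_lt_top.ne,
      one_mul]
    exact h
  rw [ENNReal.ofReal_eq_one, abs_inv, inv_eq_one] at h1
  exact h1

theorem hasDerivAt_dil (s : ℝ) (z : Heis n) : HasDerivAt (fun s => dil s z) (Zvf (dil s z)) s := by
  refine hasDerivAt_pi.2 (coord_cases (fun i => ?_) (fun i => ?_) ?_)
  · simpa using (Real.hasDerivAt_exp s).mul_const (z (xIdx n i))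
  · simpa using (Real.hasDerivAt_exp s).mul_const (z (yIdx n i))
  · have := (((hasDerivAt_id s).const_mul 2).exp).mul_const (z (tIdx n))
    simp only [dil_tIdx, Zvf_tIdx]
    refine this.congr_deriv ?_
    simp; ring

theorem hasDerivAt_rot (s : ℝ) (z : Heis n) :
    HasDerivAt (fun s => rot s z) (rotGen (rot s z)) s := by
  refine hasDerivAt_pi.2 (coord_cases (fun i => ?_) (fun i => ?_) ?_)
  · simp only [rot_xIdx, rot_yIdx, rotGen_xIdx]
    exact (((Real.hasDerivAt_cos s).mul_const _).add
      ((Real.hasDerivAt_sin s).mul_const _)).congr_deriv (by ring)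
  · simp only [rot_xIdx, rot_yIdx, rotGen_yIdx]
    exact (((Real.hasDerivAt_cos s).mul_const _).sub
      ((Real.hasDerivAt_sin s).mul_const _)).congr_deriv (by ring)
  · simpa using hasDerivAt_const s (z (tIdx n))

theorem continuous_dil : Continuous fun q : ℝ × Heis n => dil q.1 q.2 := by
  refine continuous_pi (coord_cases ?_ ?_ ?_) <;> intros <;> simp <;> fun_prop

theorem continuous_rot : Continuous fun q : ℝ × Heis n => rot q.1 q.2 := by
  refine continuous_pi (coord_cases ?_ ?_ ?_) <;> intros <;> simp <;> fun_prop

theorem fderiv_apply_eq (φ : Heis n → ℝ) (z v : Heis n) :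
    fderiv ℝ φ z v = ∑ i : Fin n, (v (xIdx n i) * grad φ z (xIdx n i)
      + v (yIdx n i) * grad φ z (yIdx n i)) + v (tIdx n) * grad φ z (tIdx n) := by
  rw [← sum_coord fun k => v k * grad φ z k]
  conv_lhs => rw [pi_eq_sum_univ' v, map_sum]
  refine Finset.sum_congr rfl fun k _ => ?_
  rw [map_smul, smul_eq_mul, grad]

/-- The weak divergence-free property of `Zvf` against a weight of degree `-Q`. -/
theorem integral_mul_fderiv_Zvf_eq_zero (g : Heis n → ℝ) (hgm : Measurable g)
    (hgint : ∀ K : Set (Heis n), IsCompact K → (0 : Heis n) ∉ K → IntegrableOn g K)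
    (hg : ∀ s z, Real.exp ((2 * n + 2) * s) * g (dil s z) = g z)
    (φ : Heis n → ℝ) (hφ : ContDiff ℝ 1 φ) (hφc : HasCompactSupport φ)
    (hφ0 : (0 : Heis n) ∉ tsupport φ) :
    Integrable (fun z => g z * fderiv ℝ φ z (Zvf z)) ∧
      ∫ z, g z * fderiv ℝ φ z (Zvf z) = 0 := by
  refine integral_mul_fderiv_flow_eq_zero volume dilLin Zvf continuous_Zvf ?_ ?_ ?_ ?_ g hgm hgint
    ?_ φ hφ hφc hφ0
  · simpa only [dilLin_apply] using continuous_dil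
  · simpa only [dilLin_apply] using hasDerivAt_dil
  · intro z; rw [dilLin_apply]; ext k; simp [dil]
  · intro s z; simp only [dilLin_apply]; ext k
    simp only [dil]
    split_ifs <;> simp [Real.exp_neg]
  · intro s z; rw [det_dilLin, abs_of_pos (Real.exp_pos _), dilLin_apply, hg]

/-- The weak divergence-free property of `rotGen` against a rotation invariant weight. -/
theorem integral_mul_fderiv_rotGen_eq_zero (g : Heis n → ℝ) (hgm : Measurable g)
    (hgint : ∀ K : Set (Heis n), IsCompact K → (0 : Heis n) ∉ K → IntegrableOn g K)
    (hg : ∀ s z, g (rot s z) = g z)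
    (φ : Heis n → ℝ) (hφ : ContDiff ℝ 1 φ) (hφc : HasCompactSupport φ)
    (hφ0 : (0 : Heis n) ∉ tsupport φ) :
    Integrable (fun z => g z * fderiv ℝ φ z (rotGen z)) ∧
      ∫ z, g z * fderiv ℝ φ z (rotGen z) = 0 := by
  refine integral_mul_fderiv_flow_eq_zero volume rotLin rotGen continuous_rotGen continuous_rot
    hasDerivAt_rot (fun z => ?_) rot_neg_rot g hgm hgint (fun s z => ?_) φ hφ hφc hφ0
  · ext k; simp [rotLin, rot]
  · rw [abs_det_rotLin, one_mul]; exact hg s z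


theorem xIdx_inj {i j : Fin n} : xIdx n i = xIdx n j ↔ i = j := by
  simp [xIdx, Fin.ext_iff]

theorem yIdx_inj {i j : Fin n} : yIdx n i = yIdx n j ↔ i = j := by
  simp [yIdx, Fin.ext_iff]

theorem xIdx_ne_yIdx (i j : Fin n) : xIdx n i ≠ yIdx n j := by
  have := i.isLt; simp only [xIdx, yIdx, ne_eq, Fin.mk.injEq]; omega

theorem xIdx_ne_tIdx (i : Fin n) : xIdx n i ≠ tIdx n := by
  have := i.isLt; simp only [xIdx, tIdx, ne_eq, Fin.mk.injEq]; omega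

theorem yIdx_ne_tIdx (i : Fin n) : yIdx n i ≠ tIdx n := by
  have := i.isLt; simp only [yIdx, tIdx, ne_eq, Fin.mk.injEq]; omega

theorem hasFDerivAt_coord (k : Fin (2 * n + 1)) (z : Heis n) :
    HasFDerivAt (fun z : Heis n => z k)
      (ContinuousLinearMap.proj (R := ℝ) (φ := fun _ => ℝ) k) z :=
  (ContinuousLinearMap.proj (R := ℝ) (φ := fun _ : Fin (2 * n + 1) => ℝ) k).hasFDerivAt

theorem fderiv_gaugeFourth (z v : Heis n) :
    fderiv ℝ gaugeFourth z v = 2 * horSq z * (∑ i : Fin n, (2 * z (xIdx n i) * v (xIdx n i)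
      + 2 * z (yIdx n i) * v (yIdx n i))) + 2 * z (tIdx n) * v (tIdx n) := by
  have hS := HasFDerivAt.fun_sum (u := Finset.univ) fun (i : Fin n) _ =>
    ((hasFDerivAt_coord (xIdx n i) z).pow 2).add ((hasFDerivAt_coord (yIdx n i) z).pow 2)
  have hN : HasFDerivAt gaugeFourth _ z := (hS.pow 2).add ((hasFDerivAt_coord (tIdx n) z).pow 2)
  rw [hN.fderiv]
  simp [horSq]

theorem differentiable_gaugeFourth : Differentiable ℝ (gaugeFourth (n := n)) := by
  unfold gaugeFourth horSq; fun_prop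

theorem Xd_gaugeFourth (i : Fin n) (z : Heis n) :
    Xd i gaugeFourth z = 4 * (horSq z * z (xIdx n i) + z (tIdx n) * z (yIdx n i)) := by
  simp only [Xd, grad, fderiv_gaugeFourth, Pi.single_apply, xIdx_inj, xIdx_ne_tIdx,
    (xIdx_ne_tIdx _).symm, yIdx_ne_tIdx, (xIdx_ne_yIdx _ _).symm]
  simp
  ring

theorem Yd_gaugeFourth (i : Fin n) (z : Heis n) :
    Yd i gaugeFourth z = 4 * (horSq z * z (yIdx n i) - z (tIdx n) * z (xIdx n i)) := by
  simp only [Yd, grad, fderiv_gaugeFourth, Pi.single_apply, yIdx_inj, xIdx_ne_tIdx,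
    (yIdx_ne_tIdx _).symm, yIdx_ne_tIdx, xIdx_ne_yIdx]
  simp
  ring

theorem sum_horizontal_gaugeFourth (φ : Heis n → ℝ) (z : Heis n) :
    ∑ i : Fin n, (Xd i gaugeFourth z * Xd i φ z + Yd i gaugeFourth z * Yd i φ z)
      = 4 * (horSq z * fderiv ℝ φ z (Zvf z) + z (tIdx n) * fderiv ℝ φ z (rotGen z)) := by
  simp only [Xd_gaugeFourth, Yd_gaugeFourth, fderiv_apply_eq, Zvf_xIdx, Zvf_yIdx, Zvf_tIdx,
    rotGen_xIdx, rotGen_yIdx, rotGen_tIdx, zero_mul, add_zero]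
  have : horSq z * (2 * z (tIdx n) * grad φ z (tIdx n)) = ∑ i : Fin n,
      (z (xIdx n i) ^ 2 + z (yIdx n i) ^ 2) * (2 * z (tIdx n) * grad φ z (tIdx n)) := by
    rw [horSq, Finset.sum_mul]
  rw [mul_add (horSq z), this, Finset.mul_sum, Finset.mul_sum, ← Finset.sum_add_distrib,
    ← Finset.sum_add_distrib, Finset.mul_sum]
  refine Finset.sum_congr rfl fun i _ => ?_
  simp only [Xd, Yd]
  ring

theorem sum_sq_horizontal_gaugeFourth (z : Heis n) :
    ∑ i : Fin n, (Xd i gaugeFourth z ^ 2 + Yd i gaugeFourth z ^ 2)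
      = 4 ^ 2 * (horSq z * gaugeFourth z) := by
  rw [gaugeFourth]
  conv_rhs => rw [horSq, Finset.sum_mul, Finset.mul_sum]
  refine Finset.sum_congr rfl fun i _ => ?_
  rw [Xd_gaugeFourth, Yd_gaugeFourth, ← horSq]
  ring

/-- The radial function `(ρ^(4a) - c) / D`. -/
def radialPower (a c D : ℝ) (z : Heis n) : ℝ := (gaugeFourth z ^ a - c) / D

theorem grad_radialPower (a c D : ℝ) {z : Heis n} (hz : z ≠ 0) (k : Fin (2 * n + 1)) :
    grad (radialPower a c D) z k = a / D * gaugeFourth z ^ (a - 1) * grad gaugeFourth z k := by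
  have h : HasFDerivAt (radialPower a c D) _ z :=
    (((differentiable_gaugeFourth z).hasFDerivAt.rpow_const (p := a)
      (Or.inl (gaugeFourth_pos hz).ne')).sub_const c).mul_const D⁻¹
  rw [grad, h.fderiv]
  simp only [smul_apply, smul_eq_mul, grad]
  ring

theorem Xd_radialPower (a c D : ℝ) {z : Heis n} (hz : z ≠ 0) (i : Fin n) :
    Xd i (radialPower a c D) z = a / D * gaugeFourth z ^ (a - 1) * Xd i gaugeFourth z := by
  simp only [Xd, grad_radialPower a c D hz]; ring

theorem Yd_radialPower (a c D : ℝ) {z : Heis n} (hz : z ≠ 0) (i : Fin n) :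
    Yd i (radialPower a c D) z = a / D * gaugeFourth z ^ (a - 1) * Yd i gaugeFourth z := by
  simp only [Yd, grad_radialPower a c D hz]; ring

theorem hNorm_radialPower (a c D : ℝ) {z : Heis n} (hz : z ≠ 0) :
    hNorm (radialPower a c D) z
      = |a / D| * gaugeFourth z ^ (a - 1) * (4 * Real.sqrt (horSq z * gaugeFourth z)) := by
  have h : ∑ i : Fin n, (Xd i (radialPower a c D) z ^ 2 + Yd i (radialPower a c D) z ^ 2)
      = (|a / D| * gaugeFourth z ^ (a - 1) * 4) ^ 2 * (horSq z * gaugeFourth z) := by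
    rw [mul_pow, mul_assoc, ← sum_sq_horizontal_gaugeFourth, Finset.mul_sum, mul_pow, sq_abs]
    refine Finset.sum_congr rfl fun i _ => ?_
    rw [Xd_radialPower a c D hz, Yd_radialPower a c D hz]
    ring
  have hN := gaugeFourth_nonneg z
  rw [hNorm, h, Real.sqrt_mul (sq_nonneg _), Real.sqrt_sq (by positivity)]
  ring

theorem flux_radialPower (a c D p : ℝ) (φ : Heis n → ℝ) {z : Heis n} (hz : z ≠ 0) :
    hNorm (radialPower a c D) z ^ (p - 2) *
      (∑ i : Fin n, (Xd i (radialPower a c D) z * Xd i φ z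
        + Yd i (radialPower a c D) z * Yd i φ z)) =
    |a / D| ^ (p - 2) * (a / D) * 4 ^ (p - 1) *
      (horSq z ^ ((p - 2) / 2) * gaugeFourth z ^ ((a - 1) * (p - 1) + (p - 2) / 2)
        * (horSq z * fderiv ℝ φ z (Zvf z) + z (tIdx n) * fderiv ℝ φ z (rotGen z))) := by
  have hS := horSq_nonneg z
  have hN := gaugeFourth_pos hz
  have hsum : ∑ i : Fin n, (Xd i (radialPower a c D) z * Xd i φ z
        + Yd i (radialPower a c D) z * Yd i φ z) = a / D * gaugeFourth z ^ (a - 1) *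
      ∑ i : Fin n, (Xd i gaugeFourth z * Xd i φ z + Yd i gaugeFourth z * Yd i φ z) := by
    rw [Finset.mul_sum]
    refine Finset.sum_congr rfl fun i _ => ?_
    rw [Xd_radialPower a c D hz, Yd_radialPower a c D hz]
    ring
  rw [hsum, sum_horizontal_gaugeFourth, hNorm_radialPower a c D hz,
    Real.mul_rpow (by positivity) (by positivity), Real.mul_rpow (abs_nonneg _) (by positivity),
    Real.mul_rpow (by norm_num) (Real.sqrt_nonneg _), Real.sqrt_eq_rpow,
    ← Real.rpow_mul hN.le, ← Real.rpow_mul (by positivity : 0 ≤ horSq z * gaugeFourth z),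
    Real.mul_rpow hS hN.le, one_div_mul_eq_div,
    show (a - 1) * (p - 1) + (p - 2) / 2 = (a - 1) * (p - 2) + (p - 2) / 2 + (a - 1) by ring,
    Real.rpow_add hN, Real.rpow_add hN,
    show (p - 1 : ℝ) = p - 2 + 1 by ring, Real.rpow_add_one (by norm_num : (4 : ℝ) ≠ 0)]
  ring

/-- The closed region `ρ⁴ ≤ (k + 1) |(x, y)|⁴` away from the vertical axis. -/
def cone (n k : ℕ) : Set (Heis n) := {z | gaugeFourth z ≤ (k + 1) * horSq z ^ 2}

theorem isClosed_cone (k : ℕ) : IsClosed (cone n k) :=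
  isClosed_le continuous_gaugeFourth (continuous_const.mul (continuous_horSq.pow 2))

theorem horSq_pos_of_mem_cone {k : ℕ} {z : Heis n} (hz : z ≠ 0) (h : z ∈ cone n k) :
    0 < horSq z := by
  refine lt_of_le_of_ne (horSq_nonneg z) fun h0 => ?_
  have h : gaugeFourth z ≤ (k + 1) * horSq z ^ 2 := h
  have := gaugeFourth_pos hz
  rw [← h0] at h
  norm_num at h
  linarith

theorem monotone_cone : Monotone (cone n) := by
  intro j k hjk z (hz : gaugeFourth z ≤ _)
  change gaugeFourth z ≤ _
  refine hz.trans (mul_le_mul_of_nonneg_right ?_ (sq_nonneg _))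
  exact_mod_cast Nat.succ_le_succ hjk

theorem mem_iUnion_cone {z : Heis n} (hz : 0 < horSq z) : z ∈ ⋃ k, cone n k := by
  obtain ⟨k, hk⟩ := exists_nat_ge (gaugeFourth z / horSq z ^ 2)
  refine mem_iUnion.2 ⟨k, ?_⟩
  rw [div_le_iff₀ (by positivity)] at hk
  change gaugeFourth z ≤ _
  nlinarith [sq_nonneg (horSq z)]

theorem dil_mem_cone (k : ℕ) (s : ℝ) (z : Heis n) : dil s z ∈ cone n k ↔ z ∈ cone n k := by
  change gaugeFourth _ ≤ _ ↔ gaugeFourth _ ≤ _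
  rw [gaugeFourth_dil, horSq_dil, mul_pow, ← Real.exp_nat_mul, mul_left_comm,
    show ((2 : ℕ) : ℝ) * (2 * s) = 4 * s by push_cast; ring]
  exact mul_le_mul_iff_of_pos_left (Real.exp_pos _)

theorem rot_mem_cone (k : ℕ) (s : ℝ) (z : Heis n) : rot s z ∈ cone n k ↔ z ∈ cone n k := by
  change gaugeFourth _ ≤ _ ↔ gaugeFourth _ ≤ _
  rw [gaugeFourth_rot, horSq_rot]

theorem measurable_weight (b e : ℝ) (f : Heis n → ℝ) (hf : Continuous f) :
    Measurable fun z => horSq z ^ b * gaugeFourth z ^ e * f z :=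
  ((continuous_horSq.measurable.pow_const b).mul
    (continuous_gaugeFourth.measurable.pow_const e)).mul hf.measurable

theorem integrableOn_indicator_cone (k : ℕ) (b e : ℝ) (f : Heis n → ℝ) (hf : Continuous f)
    (K : Set (Heis n)) (hK : IsCompact K) (hK0 : (0 : Heis n) ∉ K) :
    IntegrableOn ((cone n k).indicator fun z => horSq z ^ b * gaugeFourth z ^ e * f z) K := by
  rw [IntegrableOn, integrable_indicator_iff (isClosed_cone k).measurableSet, IntegrableOn,
    Measure.restrict_restrict (isClosed_cone k).measurableSet, inter_comm]
  refine ContinuousOn.integrableOn_compact (hK.inter_right (isClosed_cone k)) ?_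
  have hne : ∀ z ∈ K, z ≠ 0 := fun z hz h => hK0 (h ▸ hz)
  refine ((continuous_horSq.continuousOn.rpow_const fun z hz => Or.inl ?_).mul
    (continuous_gaugeFourth.continuousOn.rpow_const fun z hz => Or.inl ?_)).mul hf.continuousOn
  · exact (horSq_pos_of_mem_cone (hne z hz.1) hz.2).ne'
  · exact (gaugeFourth_pos (hne z hz.1)).ne'

theorem setIntegral_cone_eq_zero (k : ℕ) (b e : ℝ) (hbe : 2 * n + 4 + 2 * b + 4 * e = 0)
    (φ : Heis n → ℝ) (hφ : ContDiff ℝ 1 φ) (hφc : HasCompactSupport φ)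
    (hφ0 : (0 : Heis n) ∉ tsupport φ) :
    ∫ z in cone n k, horSq z ^ b * gaugeFourth z ^ e
      * (horSq z * fderiv ℝ φ z (Zvf z) + z (tIdx n) * fderiv ℝ φ z (rotGen z)) = 0 := by
  have hC : MeasurableSet (cone n k) := (isClosed_cone k).measurableSet
  have ht : Continuous fun z : Heis n => z (tIdx n) := continuous_apply _
  have hdil : ∀ (s : ℝ) (z : Heis n), Real.exp ((2 * n + 2) * s) *
      (cone n k).indicator (fun z => horSq z ^ b * gaugeFourth z ^ e * horSq z) (dil s z)
        = (cone n k).indicator (fun z => horSq z ^ b * gaugeFourth z ^ e * horSq z) z := by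
    intro s z
    by_cases hz : z ∈ cone n k
    swap
    · rw [indicator_of_notMem hz, indicator_of_notMem (mt (dil_mem_cone k s z).1 hz), mul_zero]
    rw [indicator_of_mem hz, indicator_of_mem ((dil_mem_cone k s z).2 hz), horSq_dil,
      gaugeFourth_dil, Real.mul_rpow (Real.exp_pos _).le (horSq_nonneg z),
      Real.mul_rpow (Real.exp_pos _).le (gaugeFourth_nonneg z), ← Real.exp_mul, ← Real.exp_mul]
    have h : Real.exp ((2 * n + 2) * s) * Real.exp (2 * s * b) * Real.exp (4 * s * e)
        * Real.exp (2 * s) = 1 := by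
      rw [← Real.exp_add, ← Real.exp_add, ← Real.exp_add, Real.exp_eq_one_iff]
      linear_combination s * hbe
    linear_combination horSq z ^ b * gaugeFourth z ^ e * horSq z * h
  have hrot : ∀ (s : ℝ) (z : Heis n),
      (cone n k).indicator (fun z => horSq z ^ b * gaugeFourth z ^ e * z (tIdx n)) (rot s z)
        = (cone n k).indicator (fun z => horSq z ^ b * gaugeFourth z ^ e * z (tIdx n)) z := by
    intro s z
    by_cases hz : z ∈ cone n k
    · rw [indicator_of_mem hz, indicator_of_mem ((rot_mem_cone k s z).2 hz), horSq_rot,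
        gaugeFourth_rot, rot_tIdx]
    · rw [indicator_of_notMem hz, indicator_of_notMem (mt (rot_mem_cone k s z).1 hz)]
  obtain ⟨hi₁, h₁⟩ := integral_mul_fderiv_Zvf_eq_zero _
    ((measurable_weight b e horSq continuous_horSq).indicator hC)
    (integrableOn_indicator_cone k b e horSq continuous_horSq) hdil φ hφ hφc hφ0
  obtain ⟨hi₂, h₂⟩ := integral_mul_fderiv_rotGen_eq_zero _
    ((measurable_weight b e _ ht).indicator hC) (integrableOn_indicator_cone k b e _ ht)
    hrot φ hφ hφc hφ0
  have hadd := integral_add hi₁ hi₂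
  rw [h₁, h₂, add_zero] at hadd
  rw [← integral_indicator hC, ← hadd]
  congr 1
  ext z
  by_cases hz : z ∈ cone n k
  · simp only [indicator_of_mem hz]; ring
  · simp only [indicator_of_notMem hz]; ring

theorem integral_flux_eq_zero (p a c D : ℝ) (hpa : (a - 1) * (p - 1) + (p - 2) / 2
      = -(2 * n + 2 + p) / 4)
    (φ : Heis n → ℝ) (hφ : ContDiff ℝ 1 φ) (hφc : HasCompactSupport φ)
    (hφ0 : (0 : Heis n) ∉ tsupport φ) :
    ∫ z, hNorm (radialPower a c D) z ^ (p - 2) *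
      (∑ i : Fin n, (Xd i (radialPower a c D) z * Xd i φ z
        + Yd i (radialPower a c D) z * Yd i φ z)) = 0 := by
  set F : Heis n → ℝ := fun z => hNorm (radialPower a c D) z ^ (p - 2) *
      (∑ i : Fin n, (Xd i (radialPower a c D) z * Xd i φ z
        + Yd i (radialPower a c D) z * Yd i φ z)) with hF
  by_cases hint : Integrable F
  swap
  · exact integral_undef hint
  have hfd : ∀ z, z ∉ tsupport φ → fderiv ℝ φ z = 0 := fun z hz => by
    by_contra hne
    exact hz (support_fderiv_subset ℝ hne)
  have hF0 : F 0 = 0 := by simp [hF, Xd, Yd, grad, hfd 0 hφ0]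
  have hzero : ∀ z ∉ ⋃ k, cone n k, F z = 0 := by
    intro z hz
    rcases eq_or_ne z 0 with rfl | hz0
    · exact hF0
    have hS : horSq z = 0 :=
      le_antisymm (not_lt.1 fun h => hz (mem_iUnion_cone h)) (horSq_nonneg z)
    refine mul_eq_zero_of_right _ (Finset.sum_eq_zero fun i _ => ?_)
    obtain ⟨hx, hy⟩ := horSq_eq_zero hS i
    simp [Xd_radialPower a c D hz0, Yd_radialPower a c D hz0, Xd_gaugeFourth, Yd_gaugeFourth,
      hx, hy]
  have hcone : ∀ k, ∫ z in cone n k, F z = 0 := by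
    intro k
    have h := setIntegral_cone_eq_zero k ((p - 2) / 2) (-(2 * n + 2 + p) / 4) (by ring) φ hφ hφc hφ0
    rw [← hpa] at h
    rw [← mul_zero (|a / D| ^ (p - 2) * (a / D) * 4 ^ (p - 1)), ← h, ← integral_const_mul]
    refine setIntegral_congr_fun (isClosed_cone k).measurableSet fun z _ => ?_
    rcases eq_or_ne z 0 with rfl | hz0
    · simp [hF0, hfd 0 hφ0]
    · exact flux_radialPower a c D p φ hz0
  have hlim := tendsto_setIntegral_of_monotone (fun k => (isClosed_cone (n := n) k).measurableSet)
    monotone_cone hint.integrableOn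
  simp only [hcone] at hlim
  rw [← setIntegral_eq_integral_of_forall_compl_eq_zero hzero]
  exact tendsto_nhds_unique hlim tendsto_const_nhds

theorem pHarmonicOn_radialPower (p a c D : ℝ) (hp : 1 < p)
    (hpa : a * (p - 1) = -(2 * n + 2 - p) / 4) (U : Set (Heis n)) (hU : IsOpen U)
    (hU0 : (0 : Heis n) ∉ U) : PHarmonicOn p (radialPower a c D) U := by
  have hne : ∀ z ∈ U, z ≠ 0 := fun z hz h => hU0 (h ▸ hz)
  have hN : ∀ b : ℝ, ContinuousOn (fun z : Heis n => gaugeFourth z ^ b) U := fun b =>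
    continuous_gaugeFourth.continuousOn.rpow_const fun z hz =>
      Or.inl (gaugeFourth_pos (hne z hz)).ne'
  have hp0 : 0 ≤ p := by linarith
  refine ⟨?_, ?_, fun φ hφ hφc hφU => ?_⟩
  · refine ContinuousOn.locallyIntegrableOn ?_ hU.measurableSet
    exact ((((hN a).sub continuousOn_const).div_const D).abs).rpow_const fun _ _ => Or.inr hp0
  · refine ContinuousOn.locallyIntegrableOn ?_ hU.measurableSet
    refine ContinuousOn.rpow_const ?_ fun _ _ => Or.inr hp0
    refine ContinuousOn.congr ?_ fun z hz => hNorm_radialPower a c D (hne z hz)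
    exact (continuousOn_const.mul (hN _)).mul (continuousOn_const.mul
      (continuous_horSq.mul continuous_gaugeFourth).sqrt.continuousOn)
  · rw [setIntegral_eq_integral_of_forall_compl_eq_zero]
    · exact integral_flux_eq_zero p a c D (by linear_combination hpa) φ hφ hφc
        fun h => hU0 (hφU h)
    · intro z hz
      have hfd : fderiv ℝ φ z = 0 := by
        by_contra h
        exact hz (hφU (support_fderiv_subset ℝ h))
      simp [Xd, Yd, grad, hfd]

theorem continuous_rho : Continuous (rho (n := n)) :=
  continuous_gaugeFourth.rpow_const fun _ => Or.inr (by norm_num)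

theorem gaugeBall_zero (R : ℝ) : gaugeBall (0 : Heis n) R = {z | rho z < R} := by
  ext z
  have h : rho (mul (inv z) 0) = rho z := by
    have hx : ∀ i : Fin n, (xIdx n i : ℕ) ≠ 2 * n := xIdx_ne
    have hy : ∀ i : Fin n, (yIdx n i : ℕ) ≠ 2 * n := yIdx_ne
    simp [rho, mul, inv, hx, hy]
  rw [gaugeBall, mem_ofPred_eq, mem_ofPred_eq, h]

theorem rho_zero : rho (0 : Heis n) = 0 := by
  rw [rho_eq, gaugeFourth_zero, Real.zero_rpow (by norm_num)]

end Heis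

/-- For `p > 1`, `p ≠ Q = 2n+2` and `0 < r < R`, the function
`u_{r,R}(z) = (ρ(z)^{−(Q−p)/(p−1)} − R^{−(Q−p)/(p−1)}) / (r^{−(Q−p)/(p−1)} − R^{−(Q−p)/(p−1)})`
solves the capacitary problem for the annulus between the concentric gauge
balls `B_ρ(O, r)` and `B_ρ(O, R)`. -/
theorem model_capacitary_potential
    (n : ℕ) (hn : 1 ≤ n) (p : ℝ) (hp : 1 < p) (hpQ : p ≠ 2 * (n : ℝ) + 2)
    (r R : ℝ) (hr : 0 < r) (hrR : r < R) :
    ContinuousOn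
      (fun z : Heis n =>
        (Heis.rho z ^ (-((2 * (n : ℝ) + 2 - p) / (p - 1)))
            - R ^ (-((2 * (n : ℝ) + 2 - p) / (p - 1)))) /
          (r ^ (-((2 * (n : ℝ) + 2 - p) / (p - 1)))
            - R ^ (-((2 * (n : ℝ) + 2 - p) / (p - 1)))))
      (closure (Heis.gaugeBall 0 R) \ Heis.gaugeBall 0 r) ∧
    Heis.PHarmonicOn p
      (fun z : Heis n =>
        (Heis.rho z ^ (-((2 * (n : ℝ) + 2 - p) / (p - 1)))
            - R ^ (-((2 * (n : ℝ) + 2 - p) / (p - 1)))) /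
          (r ^ (-((2 * (n : ℝ) + 2 - p) / (p - 1)))
            - R ^ (-((2 * (n : ℝ) + 2 - p) / (p - 1)))))
      (Heis.gaugeBall 0 R \ closure (Heis.gaugeBall 0 r)) ∧
    (∀ z ∈ frontier (Heis.gaugeBall (0 : Heis n) r),
      (Heis.rho z ^ (-((2 * (n : ℝ) + 2 - p) / (p - 1)))
          - R ^ (-((2 * (n : ℝ) + 2 - p) / (p - 1)))) /
        (r ^ (-((2 * (n : ℝ) + 2 - p) / (p - 1)))
          - R ^ (-((2 * (n : ℝ) + 2 - p) / (p - 1)))) = 1) ∧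
    (∀ z ∈ frontier (Heis.gaugeBall (0 : Heis n) R),
      (Heis.rho z ^ (-((2 * (n : ℝ) + 2 - p) / (p - 1)))
          - R ^ (-((2 * (n : ℝ) + 2 - p) / (p - 1)))) /
        (r ^ (-((2 * (n : ℝ) + 2 - p) / (p - 1)))
          - R ^ (-((2 * (n : ℝ) + 2 - p) / (p - 1)))) = 0) := by
  set α : ℝ := -((2 * (n : ℝ) + 2 - p) / (p - 1)) with hα
  have hp1 : p - 1 ≠ 0 := by linarith
  have hα0 : α ≠ 0 := neg_ne_zero.2 (div_ne_zero (sub_ne_zero.2 hpQ.symm) hp1)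
  have hR : 0 < R := hr.trans hrR
  have hfront : ∀ s, ∀ z ∈ frontier (Heis.gaugeBall (0 : Heis n) s), Heis.rho z = s := by
    intro s z hz
    rw [Heis.gaugeBall_zero] at hz
    exact frontier_lt_subset_eq Heis.continuous_rho continuous_const hz
  refine ⟨?_, ?_, fun z hz => ?_, fun z hz => ?_⟩
  · refine ((ContinuousOn.rpow_const Heis.continuous_rho.continuousOn fun z hz =>
      Or.inl ?_).sub continuousOn_const).div_const _
    rw [Heis.gaugeBall_zero r] at hz
    exact (hr.trans_le (not_lt.1 hz.2)).ne'
  · have hfun : (fun z : Heis n => (Heis.rho z ^ α - R ^ α) / (r ^ α - R ^ α))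
        = Heis.radialPower (α / 4) (R ^ α) (r ^ α - R ^ α) := by
      ext z
      rw [Heis.radialPower, Heis.rho_eq, ← Real.rpow_mul (Heis.gaugeFourth_nonneg z),
        one_div_mul_eq_div]
    rw [hfun]
    refine Heis.pHarmonicOn_radialPower p _ _ _ hp ?_ _ ?_ fun h => h.2 (subset_closure ?_)
    · rw [hα]; field_simp
    · refine IsOpen.sdiff ?_ isClosed_closure
      rw [Heis.gaugeBall_zero]
      exact isOpen_lt Heis.continuous_rho continuous_const
    · rw [Heis.gaugeBall_zero, mem_ofPred_eq, Heis.rho_zero]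
      exact hr
  · rw [hfront r z hz, div_self]
    exact sub_ne_zero.2 fun h =>
      hrR.ne ((Real.rpow_left_inj hr.le hR.le hα0).1 h)
  · rw [hfront R z hz, sub_self, zero_div]
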